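/- Fix t > 0, κ > 0, r > 0, η ≥ 8qr/t and R > max(2ηt/q, 3κ). There exists T₀ > e such that for every T ≥ T₀ the following holds: if a potential ξ_T : L_T → (0,∞) satisfies (A) there exists x ∈ L_T(0,r) with η ≤ ξ_T(x) < 2η, (B) ξ_T(y) ≤ η/2 for every y ∈ L_T(0,R) \ {x}, (C) h_T(z) ≤ t/8 for every z ∈ L_T(0,r), and (S2) there exists x' ∈ L_T(0,R+1) \ L_T(0,R) with ξ_T(x') > 2η + q(R+1)/t while ξ_T(y) < η + q(|y| − r)/t for every y ∈ L_T with y ∉ B(0,R) and y ≠ x', then: x is the unique maximizer on L_T of z ↦ m_T(z,t), x' is the unique maximizer on L_T of z ↦ λ_T(z,t), and |x − x'| > 2κ. -/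

import Mathlib

open MeasureTheory ProbabilityTheory Real

noncomputable section

/-- The ℓ¹-norm on `ℝ^d`. -/
def l1 {d : ℕ} (z : Fin d → ℝ) : ℝ := ∑ i, |z i|

/-- Membership in the rescaled lattice `L_T = {z ∈ ℝ^d : r(T) z ∈ ℤ^d}`. -/
def inLatt {d : ℕ} (rT : ℝ) (z : Fin d → ℝ) : Prop := ∀ i, ∃ m : ℤ, rT * z i = (m : ℝ)

/-- The rescaled potential `ξ_T(z) = ξ(r(T) z) / a(T)` built from the environment `ξ` on `ℤ^d`. -/
def envPot {Ω : Type*} {d : ℕ} (aT rT : ℝ) (ξ : (Fin d → ℤ) → Ω → ℝ) (ω : Ω)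
    (z : Fin d → ℝ) : ℝ :=
  ξ (fun i => ⌊rT * z i⌋) ω / aT

/-- The cost `∑_{j=1}^n q|y_{j-1} - y_j| / ξ_T(y_j)` of the path `y 0, …, y n`. -/
def pathCost {d : ℕ} (q : ℝ) (ξT : (Fin d → ℝ) → ℝ) (n : ℕ) (y : ℕ → Fin d → ℝ) : ℝ :=
  ∑ j ∈ Finset.range n, q * l1 (y j - y (j + 1)) / ξT (y (j + 1))

/-- The lilypad hitting time `h_T(z)`. -/
def hitTime {d : ℕ} (q rT : ℝ) (ξT : (Fin d → ℝ) → ℝ) (z : Fin d → ℝ) : ℝ :=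
  sInf {s : ℝ | ∃ n : ℕ, 1 ≤ n ∧ ∃ y : ℕ → Fin d → ℝ,
    (∀ j ≤ n, inLatt rT (y j)) ∧ y 0 = z ∧ y n = 0 ∧ s = pathCost q ξT n y}

/-- The rounding `[x]_T` of `x ∈ ℝ^d` to the lattice `L_T`. -/
def roundT {d : ℕ} (rT : ℝ) (x : Fin d → ℝ) : Fin d → ℝ := fun i => (⌊rT * x i⌋ : ℝ) / rT

/-- The PAM lilypad hitting time `τ_T(z) = inf_y q(|y| + |z-y|)/ξ_T(y)`. -/
def tauT {d : ℕ} (q rT : ℝ) (ξT : (Fin d → ℝ) → ℝ) (z : Fin d → ℝ) : ℝ :=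
  sInf {s : ℝ | ∃ y : Fin d → ℝ, inLatt rT y ∧ s = q * (l1 y + l1 (z - y)) / ξT y}

/-- The BRW lilypad profile `m_T(z,t) = sup_y { ξ_T(y)(t - h_T(y))_+ - q|z-y| }`. -/
def mT {d : ℕ} (q rT : ℝ) (ξT : (Fin d → ℝ) → ℝ) (z : Fin d → ℝ) (t : ℝ) : ℝ :=
  sSup {v : ℝ | ∃ y : Fin d → ℝ, inLatt rT y ∧
    v = ξT y * max (t - hitTime q rT ξT y) 0 - q * l1 (z - y)}

/-- The PAM lilypad profile `λ_T(z,t) = sup_y { ξ_T(y) t - q|y| - q|z-y| } ∨ 0`. -/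
def lamT {d : ℕ} (q rT : ℝ) (ξT : (Fin d → ℝ) → ℝ) (z : Fin d → ℝ) (t : ℝ) : ℝ :=
  max (sSup {v : ℝ | ∃ y : Fin d → ℝ, inLatt rT y ∧
    v = ξT y * t - q * l1 y - q * l1 (z - y)}) 0

/-- `a(T) = (T / log T)^q`. -/
def aOf (q T : ℝ) : ℝ := (T / Real.log T) ^ q

/-- `r(T) = (T / log T)^(q+1)`. -/
def rOf (q T : ℝ) : ℝ := (T / Real.log T) ^ (q + 1)

end

lemma l1_nonneg {d : ℕ} (z : Fin d → ℝ) : 0 ≤ l1 z :=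
  Finset.sum_nonneg fun _ _ => abs_nonneg _

lemma l1_zero {d : ℕ} : l1 (0 : Fin d → ℝ) = 0 := by simp [l1]

lemma l1_pos {d : ℕ} {z : Fin d → ℝ} (hz : z ≠ 0) : 0 < l1 z := by
  obtain ⟨i, hi⟩ := Function.ne_iff.mp hz
  exact Finset.sum_pos' (fun _ _ => abs_nonneg _) ⟨i, Finset.mem_univ i, abs_pos.mpr hi⟩

lemma l1_sub_pos {d : ℕ} {z w : Fin d → ℝ} (h : z ≠ w) : 0 < l1 (z - w) :=
  l1_pos (sub_ne_zero.mpr h)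

lemma l1_sub_comm {d : ℕ} (z w : Fin d → ℝ) : l1 (z - w) = l1 (w - z) := by
  simp [l1, abs_sub_comm]

lemma l1_le_add_l1_sub {d : ℕ} (z w : Fin d → ℝ) : l1 z ≤ l1 w + l1 (z - w) := by
  unfold l1
  rw [← Finset.sum_add_distrib]
  refine Finset.sum_le_sum fun i _ => ?_
  simpa using abs_add_le (w i) (z i - w i)

lemma inLatt_zero {d : ℕ} (rT : ℝ) : inLatt rT (0 : Fin d → ℝ) := fun _ => ⟨0, by simp⟩

lemma pathCost_nonneg {d : ℕ} {q rT : ℝ} {ξT : (Fin d → ℝ) → ℝ} (hq : 0 ≤ q)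
    (hξ : ∀ z, inLatt rT z → 0 < ξT z) {n : ℕ} {y : ℕ → Fin d → ℝ}
    (hy : ∀ j ≤ n, inLatt rT (y j)) : 0 ≤ pathCost q ξT n y := by
  refine Finset.sum_nonneg fun j hj => ?_
  have := hξ _ (hy (j + 1) (Finset.mem_range.mp hj))
  have := l1_nonneg (y j - y (j + 1))
  positivity

lemma hitTime_nonneg {d : ℕ} {q rT : ℝ} {ξT : (Fin d → ℝ) → ℝ} (hq : 0 ≤ q)
    (hξ : ∀ z, inLatt rT z → 0 < ξT z) (z : Fin d → ℝ) : 0 ≤ hitTime q rT ξT z := by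
  refine Real.sInf_nonneg ?_
  rintro s ⟨n, -, y, hy, -, -, rfl⟩
  exact pathCost_nonneg hq hξ hy

/-- A path from outside the ball of radius `R` to the origin costs at least `q R / M` when the
potential is bounded by `M` on that ball. -/
lemma le_pathCost {d : ℕ} {q rT R M : ℝ} {ξT : (Fin d → ℝ) → ℝ} (hq : 0 ≤ q) (hR : 0 ≤ R)
    (hξ : ∀ z, inLatt rT z → 0 < ξT z)
    (hM : 0 < M) (hξM : ∀ z, inLatt rT z → l1 z < R → ξT z ≤ M) {n : ℕ} {y : ℕ → Fin d → ℝ}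
    (hy : ∀ j ≤ n, inLatt rT (y j)) (h0 : R ≤ l1 (y 0)) (hn : y n = 0) :
    q * R / M ≤ pathCost q ξT n y := by
  have htel := Finset.sum_range_sub' (fun j => q * min (l1 (y j)) R / M) n
  simp only [hn, l1_zero, min_eq_right h0, min_eq_left hR, mul_zero, zero_div, sub_zero] at htel
  rw [← htel]
  refine Finset.sum_le_sum fun j hj => ?_
  have hL := hy (j + 1) (Finset.mem_range.mp hj)
  have hpos := hξ _ hL
  have hnn := l1_nonneg (y j - y (j + 1))
  rw [← sub_div, ← mul_sub]
  by_cases hb : l1 (y (j + 1)) < R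
  · have h1 := l1_le_add_l1_sub (y j) (y (j + 1))
    have h2 : min (l1 (y j)) R - min (l1 (y (j + 1))) R ≤ l1 (y j - y (j + 1)) := by
      rw [min_eq_left hb.le]
      linarith [min_le_left (l1 (y j)) R]
    have h3 := hξM _ hL hb
    gcongr
  · have h2 : min (l1 (y j)) R - min (l1 (y (j + 1))) R ≤ 0 := by
      rw [min_eq_right (not_lt.mp hb)]
      linarith [min_le_right (l1 (y j)) R]
    exact (div_nonpos_of_nonpos_of_nonneg (mul_nonpos_of_nonneg_of_nonpos hq h2) hM.le).trans
      (by positivity)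

lemma le_hitTime {d : ℕ} {q rT R M : ℝ} {ξT : (Fin d → ℝ) → ℝ} (hq : 0 ≤ q) (hR : 0 ≤ R)
    (hξ : ∀ z, inLatt rT z → 0 < ξT z)
    (hM : 0 < M) (hξM : ∀ z, inLatt rT z → l1 z < R → ξT z ≤ M) {z : Fin d → ℝ}
    (hz : inLatt rT z) (hzR : R ≤ l1 z) : q * R / M ≤ hitTime q rT ξT z := by
  refine le_csInf ?_ ?_
  · refine ⟨_, 1, le_rfl, fun j => if j = 0 then z else 0, fun j _ => ?_, by simp, by simp, rfl⟩
    by_cases hj : j = 0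
    · simpa [hj] using hz
    · simpa [hj] using inLatt_zero rT
  · rintro s ⟨n, -, y, hy, h0, hn, rfl⟩
    exact le_pathCost hq hR hξ hM hξM hy (h0 ▸ hzR) hn

/-- If `g` has a strict maximum over the lattice at `x`, with a uniform gap `b < g x`, then the
upper envelope of the cones `g y - q |z - y|` is at least `g x` at `x`, and is smaller elsewhere. -/
lemma sSup_cones_lt {d : ℕ} {q rT b : ℝ} (hq : 0 < q) {g : (Fin d → ℝ) → ℝ} {x : Fin d → ℝ}
    (hx : inLatt rT x) (hb : b < g x) (hg : ∀ y, inLatt rT y → y ≠ x → g y ≤ b) :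
    g x ≤ sSup {v : ℝ | ∃ y, inLatt rT y ∧ v = g y - q * l1 (x - y)} ∧
      ∀ z, z ≠ x → sSup {v : ℝ | ∃ y, inLatt rT y ∧ v = g y - q * l1 (z - y)} < g x := by
  constructor
  · refine le_csSup ⟨g x, ?_⟩ ⟨x, hx, by simp [l1_zero]⟩
    rintro v ⟨y, hy, rfl⟩
    have := mul_nonneg hq.le (l1_nonneg (x - y))
    rcases eq_or_ne y x with rfl | hne
    · linarith
    · linarith [hg y hy hne]
  · intro z hz
    have hpos := mul_pos hq (l1_sub_pos hz)
    refine lt_of_le_of_lt (csSup_le (a := max b (g x - q * l1 (z - x))) ⟨_, x, hx, rfl⟩ ?_)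
      (max_lt hb (by linarith))
    rintro v ⟨y, hy, rfl⟩
    rcases eq_or_ne y x with rfl | hne
    · exact le_max_right _ _
    · have := mul_nonneg hq.le (l1_nonneg (z - y))
      exact le_max_of_le_left (by linarith [hg y hy hne])

/-- **Lemma 8.2(ii).** Under (A), (B), (C) and (S2), for large `T`: `x` is the unique
maximizer of the BRW lilypad profile `m_T(·,t)`, `x'` is the unique maximizer of the PAM
lilypad profile `λ_T(·,t)`, and `|x − x'| > 2κ`. -/
theorem different_maximizers_scenario
    (d : ℕ) (hd : 1 ≤ d) (α : ℝ) (hα : (d : ℝ) < α)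
    (q : ℝ) (hq : q = d / (α - d))
    (t κ r η R : ℝ) (ht : 0 < t) (hκ : 0 < κ) (hr : 0 < r)
    (hη : 8 * q * r / t ≤ η) (hR : max (2 * η * t / q) (3 * κ) < R) :
    ∃ T₀ : ℝ, Real.exp 1 < T₀ ∧ ∀ T : ℝ, T₀ ≤ T →
      ∀ ξT : (Fin d → ℝ) → ℝ, (∀ z, inLatt (rOf q T) z → 0 < ξT z) →
      ∀ x : Fin d → ℝ, inLatt (rOf q T) x → l1 x < r → η ≤ ξT x → ξT x < 2 * η →
      (∀ y, inLatt (rOf q T) y → l1 y < R → y ≠ x → ξT y ≤ η / 2) →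
      (∀ z, inLatt (rOf q T) z → l1 z < r → hitTime q (rOf q T) ξT z ≤ t / 8) →
      ∀ x' : Fin d → ℝ, inLatt (rOf q T) x' → l1 x' < R + 1 → ¬ l1 x' < R →
      2 * η + q * (R + 1) / t < ξT x' →
      (∀ y, inLatt (rOf q T) y → ¬ l1 y < R → y ≠ x' → ξT y < η + q * (l1 y - r) / t) →
      (∀ z, inLatt (rOf q T) z → z ≠ x →
          mT q (rOf q T) ξT z t < mT q (rOf q T) ξT x t)
      ∧ (∀ z, inLatt (rOf q T) z → z ≠ x' →
          lamT q (rOf q T) ξT z t < lamT q (rOf q T) ξT x' t)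
      ∧ 2 * κ < l1 (x - x') := by
  have hq0 : 0 < q := by
    rw [hq]
    exact div_pos (by exact_mod_cast hd) (sub_pos.mpr hα)
  have hη0 : 0 < η := lt_of_lt_of_le (by positivity) hη
  obtain ⟨hR1, hR2⟩ := max_lt_iff.mp hR
  have hR0 : 0 < R := by linarith
  rw [div_le_iff₀ ht] at hη
  rw [div_lt_iff₀ hq0] at hR1
  have hηt : 0 < η * t := mul_pos hη0 ht
  have hrR : 16 * r < R := by
    by_contra! h
    nlinarith
  refine ⟨Real.exp 1 + 1, by linarith, fun T _ ξT hξ x hx hxr hx1 hx2 hB hC x' hx' hx'R hx'R'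
    hx'ξ hS => ?_⟩
  have hle : ∀ z, inLatt (rOf q T) z → l1 z < R → ξT z ≤ 2 * η := by
    intro z hz hzR
    rcases eq_or_ne z x with rfl | hne
    · exact hx2.le
    · linarith [hB z hz hzR hne]
  refine ⟨?_, ?_, ?_⟩
  · have hgx : 7 / 8 * (η * t) ≤ ξT x * max (t - hitTime q (rOf q T) ξT x) 0 := by
      have h1 : 7 / 8 * t ≤ max (t - hitTime q (rOf q T) ξT x) 0 :=
        le_max_of_le_left (by linarith [hC x hx hxr])
      calc 7 / 8 * (η * t) = η * (7 / 8 * t) := by ring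
        _ ≤ _ := mul_le_mul hx1 h1 (by positivity) (hξ x hx).le
    obtain ⟨h1, h2⟩ := sSup_cones_lt (b := η / 2 * t)
      (g := fun y => ξT y * max (t - hitTime q (rOf q T) ξT y) 0) hq0 hx (by linarith)
      fun y hy hyx => by
        by_cases hyR : l1 y < R
        · refine mul_le_mul (hB y hy hyR hyx) (max_le ?_ ht.le) (le_max_right _ _) (by positivity)
          linarith [hitTime_nonneg hq0.le hξ y]
        · have h := le_hitTime hq0.le hR0.le hξ (by positivity : 0 < 2 * η) hle hy (not_lt.mp hyR)
          have h' : t ≤ q * R / (2 * η) := by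
            rw [le_div_iff₀ (by positivity)]
            linarith
          rw [max_eq_right (by linarith), mul_zero]
          positivity
    exact fun z _ hzx => (h2 z hzx).trans_le h1
  · have hgx' : 2 * η * t < ξT x' * t - q * l1 x' := by
      have h1 : 2 * η * t + q * (R + 1) < ξT x' * t := by
        have := mul_lt_mul_of_pos_right hx'ξ ht
        rwa [add_mul, div_mul_cancel₀ _ ht.ne'] at this
      linarith [mul_lt_mul_of_pos_left hx'R hq0]
    obtain ⟨h1, h2⟩ := sSup_cones_lt (b := 2 * η * t)
      (g := fun y => ξT y * t - q * l1 y) hq0 hx' hgx' fun y hy hyx => by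
        by_cases hyR : l1 y < R
        · linarith [mul_le_mul_of_nonneg_right (hle y hy hyR) ht.le,
            mul_nonneg hq0.le (l1_nonneg y)]
        · have h := mul_lt_mul_of_pos_right (hS y hy hyR hyx) ht
          rw [add_mul, div_mul_cancel₀ _ ht.ne'] at h
          linarith [mul_pos hq0 hr]
    intro z _ hzx
    exact (max_lt (h2 z hzx) (by linarith)).trans_le (le_max_of_le_left h1)
  · have h := l1_le_add_l1_sub x' x
    rw [l1_sub_comm x' x] at h
    linarith
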